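/- Variation of φ̂ (key linearization lemma): the map φ ↦ φ̂ is differentiable on the open set U := {φ ∈ Λ³(ℝ⁶)* : λ_φ < 0}, φ ∧ φ̂ = 2√(−λ_φ)·vol ≠ 0 on U, and for every φ ∈ U and every μ ∈ Λ³(ℝ⁶)* the derivative of φ ↦ φ̂ at φ in the direction μ equals −μ∘(J_φ × J_φ × J_φ) + 2r₁·φ + 2r₂·φ̂, where (μ∘(J_φ×J_φ×J_φ))(x,y,z) := μ(J_φx, J_φy, J_φz) and r₁, r₂ ∈ ℝ are the real numbers determined by μ ∧ φ = r₁·(φ ∧ φ̂) and μ ∧ φ̂ = r₂·(φ ∧ φ̂). -/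

import Mathlib

noncomputable section

/-- The underlying vector space `ℝ⁶`. -/
abbrev V6 : Type := Fin 6 → ℝ

/-- The space of component arrays of trilinear forms on `ℝ⁶`. -/
abbrev A6 : Type := Fin 6 → Fin 6 → Fin 6 → ℝ

/-- The standard basis of `ℝ⁶`. -/
def e6 (i : Fin 6) : V6 := fun j => if j = i then (1 : ℝ) else 0

/-- The trilinear form with component array `c`. -/
def tri (c : A6) (x y z : V6) : ℝ :=
  ∑ i : Fin 6, ∑ j : Fin 6, ∑ k : Fin 6, c i j k * x i * y j * z k

/-- The volume form `vol = e¹∧⋯∧e⁶ = ω³/3!`. -/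
def vol6 (v : Fin 6 → V6) : ℝ := (Matrix.of fun i j => v i j).det

/-- Wedge product of a 2-form and a 3-form (standard convention `1/(2!·3!)`). -/
def wedge23 (a : V6 → V6 → ℝ) (b : V6 → V6 → V6 → ℝ) (v : Fin 5 → V6) : ℝ :=
  (1 / 12 : ℝ) * ∑ σ : Equiv.Perm (Fin 5),
    ((Equiv.Perm.sign σ : ℤ) : ℝ) *
      (a (v (σ 0)) (v (σ 1)) * b (v (σ 2)) (v (σ 3)) (v (σ 4)))

/-- Wedge product of two 3-forms (standard convention `1/(3!·3!)`). -/
def wedge33 (a b : V6 → V6 → V6 → ℝ) (v : Fin 6 → V6) : ℝ :=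
  (1 / 36 : ℝ) * ∑ σ : Equiv.Perm (Fin 6),
    ((Equiv.Perm.sign σ : ℤ) : ℝ) *
      (a (v (σ 0)) (v (σ 1)) (v (σ 2)) * b (v (σ 3)) (v (σ 4)) (v (σ 5)))

/-- Hitchin's map `K_φ`, characterized by `ι_{K_φ v} vol = -(ι_v φ) ∧ φ`. -/
def Kmap (φ : V6 → V6 → V6 → ℝ) (x : V6) : V6 := fun i =>
  (-1 : ℝ) ^ (i : ℕ) *
    (-(wedge23 (fun y z => φ x y z) φ (fun j => e6 (i.succAbove j))))

/-- Hitchin's invariant `λ_φ = (1/6)·tr(K_φ²)`. -/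
def lamH (φ : V6 → V6 → V6 → ℝ) : ℝ :=
  (1 / 6 : ℝ) * ∑ i : Fin 6, Kmap φ (Kmap φ (e6 i)) i

/-- Hitchin's almost complex structure `J_φ = K_φ / √(-λ_φ)`. -/
def Jmap (φ : V6 → V6 → V6 → ℝ) (x : V6) : V6 :=
  (Real.sqrt (-(lamH φ)))⁻¹ • Kmap φ x

/-- `φ̂(x,y,z) = φ(J_φ x, J_φ y, J_φ z)`. -/
def hatf (φ : V6 → V6 → V6 → ℝ) (x y z : V6) : ℝ :=
  φ (Jmap φ x) (Jmap φ y) (Jmap φ z)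

/-- The space `Λ³(ℝ⁶)*` of 3-forms, realized as the submodule of alternating component
arrays. -/
def altForms : Submodule ℝ A6 where
  carrier := {c | (∀ i j k, c i j k = -c i k j) ∧ (∀ i j k, c i j k = -c j i k)}
  add_mem' := by
    rintro a b ⟨ha1, ha2⟩ ⟨hb1, hb2⟩
    refine ⟨fun i j k => ?_, fun i j k => ?_⟩
    · simp only [Pi.add_apply]
      linarith [ha1 i j k, hb1 i j k]
    · simp only [Pi.add_apply]
      linarith [ha2 i j k, hb2 i j k]
  zero_mem' := by
    constructor <;> intro i j k <;> simp
  smul_mem' := by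
    rintro r a ⟨ha1, ha2⟩
    refine ⟨fun i j k => ?_, fun i j k => ?_⟩
    · simp only [Pi.smul_apply, smul_eq_mul]
      rw [ha1 i j k]; ring
    · simp only [Pi.smul_apply, smul_eq_mul]
      rw [ha2 i j k]; ring


/-- The map `φ ↦ φ̂`, with values recorded as component arrays. -/
def hatMap (c : altForms) : A6 := fun i j k => hatf (tri c.1) (e6 i) (e6 j) (e6 k)


/-- The antisymmetrisation of `G` over all permutations of the entries of `v`. -/
def antisymSum {n : ℕ} {α : Type*} (v : Fin n → α) (G : (Fin n → α) → ℝ) : ℝ :=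
  ∑ σ : Equiv.Perm (Fin n), ((Equiv.Perm.sign σ : ℤ) : ℝ) * G (v ∘ σ)

/-- Splitting an antisymmetrised sum according to the image of `0`. -/
theorem antisymSum_succ {n : ℕ} {α : Type*} (v : Fin (n + 1) → α)
    (G : (Fin (n + 1) → α) → ℝ) :
    antisymSum v G = ∑ p : Fin (n + 1), (if p = 0 then 1 else -1) *
      antisymSum (fun i => v (Equiv.swap 0 p (Fin.succ i)))
        (fun w => G (Matrix.vecCons (v p) w)) := by
  unfold antisymSum
  rw [Finset.univ_perm_fin_succ, Finset.sum_map, Finset.univ_product_univ.symm,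
    Finset.sum_product]
  refine Finset.sum_congr rfl fun p _ => ?_
  rw [Finset.mul_sum]
  refine Finset.sum_congr rfl fun τ _ => ?_
  have hG : v ∘ (Equiv.Perm.decomposeFin.symm (p, τ)) =
      Matrix.vecCons (v p) ((fun i => v (Equiv.swap 0 p (Fin.succ i))) ∘ τ) := by
    funext i
    refine Fin.cases ?_ (fun i => ?_) i <;> simp
  simp only [Equiv.toEmbedding_apply, hG, Equiv.Perm.decomposeFin.symm_sign]
  split_ifs <;> simp

theorem antisymSum_zero {α : Type*} (v : Fin 0 → α) (G : (Fin 0 → α) → ℝ) :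
    antisymSum v G = G ![] := by
  simp [antisymSum, Subsingleton.elim (v ∘ _) ![]]

theorem antisymSum_one {α : Type*} (a : α) (G : (Fin 1 → α) → ℝ) :
    antisymSum ![a] G = G ![a] := by
  simp [antisymSum_succ, antisymSum_zero]

theorem antisymSum_two {α : Type*} (a b : α) (G : (Fin 2 → α) → ℝ) :
    antisymSum ![a, b] G = G ![a, b] - G ![b, a] := by
  rw [antisymSum_succ, Fin.sum_univ_two]
  have h : (fun i : Fin 1 => ![a, b] (Equiv.swap 0 0 (Fin.succ i))) = ![b] := by
    funext i; fin_cases i; rfl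
  have h' : (fun i : Fin 1 => ![a, b] (Equiv.swap 0 1 (Fin.succ i))) = ![a] := by
    funext i; fin_cases i; rfl
  rw [h, h']
  simp [antisymSum_one, sub_eq_add_neg]

theorem antisymSum_three {α : Type*} (a b c : α) (G : (Fin 3 → α) → ℝ) :
    antisymSum ![a, b, c] G =
      antisymSum ![b, c] (fun w => G (Matrix.vecCons a w))
      - antisymSum ![a, c] (fun w => G (Matrix.vecCons b w))
      - antisymSum ![b, a] (fun w => G (Matrix.vecCons c w)) := by
  have h (p : Fin 3) : (fun i : Fin 2 => ![a, b, c] (Equiv.swap 0 p (Fin.succ i))) =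
      ![![b, c], ![a, c], ![b, a]] p := by
    funext i; fin_cases p <;> fin_cases i <;> rfl
  simp only [antisymSum_succ ![a, b, c], h, Fin.sum_univ_succ]
  simp
  ring

theorem antisymSum_four {α : Type*} (a b c d : α) (G : (Fin 4 → α) → ℝ) :
    antisymSum ![a, b, c, d] G =
      antisymSum ![b, c, d] (fun w => G (Matrix.vecCons a w))
      - antisymSum ![a, c, d] (fun w => G (Matrix.vecCons b w))
      - antisymSum ![b, a, d] (fun w => G (Matrix.vecCons c w))
      - antisymSum ![b, c, a] (fun w => G (Matrix.vecCons d w)) := by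
  have h (p : Fin 4) : (fun i : Fin 3 => ![a, b, c, d] (Equiv.swap 0 p (Fin.succ i))) =
      ![![b, c, d], ![a, c, d], ![b, a, d], ![b, c, a]] p := by
    funext i; fin_cases p <;> fin_cases i <;> rfl
  simp only [antisymSum_succ ![a, b, c, d], h, Fin.sum_univ_succ]
  simp
  ring

theorem antisymSum_five {α : Type*} (a b c d e : α) (G : (Fin 5 → α) → ℝ) :
    antisymSum ![a, b, c, d, e] G =
      antisymSum ![b, c, d, e] (fun w => G (Matrix.vecCons a w))
      - antisymSum ![a, c, d, e] (fun w => G (Matrix.vecCons b w))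
      - antisymSum ![b, a, d, e] (fun w => G (Matrix.vecCons c w))
      - antisymSum ![b, c, a, e] (fun w => G (Matrix.vecCons d w))
      - antisymSum ![b, c, d, a] (fun w => G (Matrix.vecCons e w)) := by
  have h (p : Fin 5) : (fun i : Fin 4 => ![a, b, c, d, e] (Equiv.swap 0 p (Fin.succ i))) =
      ![![b, c, d, e], ![a, c, d, e], ![b, a, d, e], ![b, c, a, e], ![b, c, d, a]] p := by
    funext i; fin_cases p <;> fin_cases i <;> rfl
  simp only [antisymSum_succ ![a, b, c, d, e], h, Fin.sum_univ_succ]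
  simp
  ring

theorem antisymSum_six {α : Type*} (a b c d e f : α) (G : (Fin 6 → α) → ℝ) :
    antisymSum ![a, b, c, d, e, f] G =
      antisymSum ![b, c, d, e, f] (fun w => G (Matrix.vecCons a w))
      - antisymSum ![a, c, d, e, f] (fun w => G (Matrix.vecCons b w))
      - antisymSum ![b, a, d, e, f] (fun w => G (Matrix.vecCons c w))
      - antisymSum ![b, c, a, e, f] (fun w => G (Matrix.vecCons d w))
      - antisymSum ![b, c, d, a, f] (fun w => G (Matrix.vecCons e w))
      - antisymSum ![b, c, d, e, a] (fun w => G (Matrix.vecCons f w)) := by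
  have h (p : Fin 6) : (fun i : Fin 5 => ![a, b, c, d, e, f] (Equiv.swap 0 p (Fin.succ i))) =
      ![![b, c, d, e, f], ![a, c, d, e, f], ![b, a, d, e, f], ![b, c, a, e, f],
        ![b, c, d, a, f], ![b, c, d, e, a]] p := by
    funext i; fin_cases p <;> fin_cases i <;> rfl
  simp only [antisymSum_succ ![a, b, c, d, e, f], h, Fin.sum_univ_succ]
  simp
  ring

/-- An antisymmetrised sum of a function that is already alternating in three arguments. -/
theorem antisymSum_three_of_alternating {α : Type*} {B : α → α → α → ℝ}
    (hB : ∀ i j k, B i j k = -B i k j) (hB' : ∀ i j k, B i j k = -B j i k)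
    (r : ℝ) (a b c : α) :
    antisymSum ![a, b, c] (fun w => r * B (w 0) (w 1) (w 2)) = 6 * r * B a b c := by
  simp only [antisymSum_three, antisymSum_two]
  simp
  rw [hB a c b, hB' b a c, hB' c b a, hB b c a, hB' b a c, hB' c a b, hB a c b]
  ring

theorem sum_perm_five_of_alternating {A : Fin 5 → Fin 5 → ℝ} {B : Fin 5 → Fin 5 → Fin 5 → ℝ}
    (hA : ∀ i j, A i j = -A j i) (hB : ∀ i j k, B i j k = -B i k j)
    (hB' : ∀ i j k, B i j k = -B j i k) :
    ∑ σ : Equiv.Perm (Fin 5), ((Equiv.Perm.sign σ : ℤ) : ℝ) *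
      (A (σ 0) (σ 1) * B (σ 2) (σ 3) (σ 4)) =
    12 * (A 0 1 * B 2 3 4 - A 0 2 * B 1 3 4 + A 0 3 * B 1 2 4 - A 0 4 * B 1 2 3
      + A 1 2 * B 0 3 4 - A 1 3 * B 0 2 4 + A 1 4 * B 0 2 3 + A 2 3 * B 0 1 4
      - A 2 4 * B 0 1 3 + A 3 4 * B 0 1 2) := by
  have key : antisymSum ![0, 1, 2, 3, 4] (fun w => A (w 0) (w 1) * B (w 2) (w 3) (w 4)) =
      ∑ σ : Equiv.Perm (Fin 5), ((Equiv.Perm.sign σ : ℤ) : ℝ) *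
        (A (σ 0) (σ 1) * B (σ 2) (σ 3) (σ 4)) := by
    have hid : (![0, 1, 2, 3, 4] : Fin 5 → Fin 5) = id := by
      funext i; fin_cases i <;> rfl
    rw [hid]
    rfl
  have hw (x y : Fin 5) (w : Fin 3 → Fin 5) :
      A (Matrix.vecCons x (Matrix.vecCons y w) 0) (Matrix.vecCons x (Matrix.vecCons y w) 1) *
        B (Matrix.vecCons x (Matrix.vecCons y w) 2) (Matrix.vecCons x (Matrix.vecCons y w) 3)
          (Matrix.vecCons x (Matrix.vecCons y w) 4) = A x y * B (w 0) (w 1) (w 2) := rfl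
  rw [← key]
  simp only [antisymSum_five, antisymSum_four, hw, antisymSum_three_of_alternating hB hB']
  have hA₁ : ∀ i j, j < i → A i j = -A j i := fun i j _ => hA i j
  have hB₁ : ∀ i j k, k < j → B i j k = -B i k j := fun i j k _ => hB i j k
  have hB₂ : ∀ i j k, j < i → B i j k = -B j i k := fun i j k _ => hB' i j k
  simp only [hA₁, hB₁, hB₂, Fin.reduceLT]
  ring

theorem sum_perm_six_of_alternating {A B : Fin 6 → Fin 6 → Fin 6 → ℝ}
    (hA : ∀ i j k, A i j k = -A i k j) (hA' : ∀ i j k, A i j k = -A j i k)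
    (hB : ∀ i j k, B i j k = -B i k j) (hB' : ∀ i j k, B i j k = -B j i k) :
    ∑ σ : Equiv.Perm (Fin 6), ((Equiv.Perm.sign σ : ℤ) : ℝ) *
      (A (σ 0) (σ 1) (σ 2) * B (σ 3) (σ 4) (σ 5)) =
    36 * (A 0 1 2 * B 3 4 5 - A 0 1 3 * B 2 4 5 + A 0 1 4 * B 2 3 5 - A 0 1 5 * B 2 3 4
      + A 0 2 3 * B 1 4 5 - A 0 2 4 * B 1 3 5 + A 0 2 5 * B 1 3 4 + A 0 3 4 * B 1 2 5
      - A 0 3 5 * B 1 2 4 + A 0 4 5 * B 1 2 3 - A 1 2 3 * B 0 4 5 + A 1 2 4 * B 0 3 5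
      - A 1 2 5 * B 0 3 4 - A 1 3 4 * B 0 2 5 + A 1 3 5 * B 0 2 4 - A 1 4 5 * B 0 2 3
      + A 2 3 4 * B 0 1 5 - A 2 3 5 * B 0 1 4 + A 2 4 5 * B 0 1 3 - A 3 4 5 * B 0 1 2) := by
  have key : antisymSum ![0, 1, 2, 3, 4, 5]
        (fun w => A (w 0) (w 1) (w 2) * B (w 3) (w 4) (w 5)) =
      ∑ σ : Equiv.Perm (Fin 6), ((Equiv.Perm.sign σ : ℤ) : ℝ) *
        (A (σ 0) (σ 1) (σ 2) * B (σ 3) (σ 4) (σ 5)) := by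
    have hid : (![0, 1, 2, 3, 4, 5] : Fin 6 → Fin 6) = id := by
      funext i; fin_cases i <;> rfl
    rw [hid]
    rfl
  have hw (x y z : Fin 6) (w : Fin 3 → Fin 6) :
      A (Matrix.vecCons x (Matrix.vecCons y (Matrix.vecCons z w)) 0)
        (Matrix.vecCons x (Matrix.vecCons y (Matrix.vecCons z w)) 1)
        (Matrix.vecCons x (Matrix.vecCons y (Matrix.vecCons z w)) 2) *
      B (Matrix.vecCons x (Matrix.vecCons y (Matrix.vecCons z w)) 3)
        (Matrix.vecCons x (Matrix.vecCons y (Matrix.vecCons z w)) 4)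
        (Matrix.vecCons x (Matrix.vecCons y (Matrix.vecCons z w)) 5) =
      A x y z * B (w 0) (w 1) (w 2) := rfl
  rw [← key]
  simp only [antisymSum_six, antisymSum_five, antisymSum_four, hw,
    antisymSum_three_of_alternating hB hB']
  have hA₁ : ∀ i j k, k < j → A i j k = -A i k j := fun i j k _ => hA i j k
  have hA₂ : ∀ i j k, j < i → A i j k = -A j i k := fun i j k _ => hA' i j k
  have hB₁ : ∀ i j k, k < j → B i j k = -B i k j := fun i j k _ => hB i j k
  have hB₂ : ∀ i j k, j < i → B i j k = -B j i k := fun i j k _ => hB' i j k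
  simp only [hA₁, hA₂, hB₁, hB₂, Fin.reduceLT]
  ring

/-- The matrix, bilinear in `(a, b)`, of the endomorphism `K` with
`ι_{K x} vol = -(ι_x a) ∧ b`. -/
def hitchinMat (a b : A6) : Matrix (Fin 6) (Fin 6) ℝ := fun i j =>
  (-1 : ℝ) ^ ((i : ℕ) + 1) *
    (a j (i.succAbove 0) (i.succAbove 1) * b (i.succAbove 2) (i.succAbove 3) (i.succAbove 4)
    - a j (i.succAbove 0) (i.succAbove 2) * b (i.succAbove 1) (i.succAbove 3) (i.succAbove 4)
    + a j (i.succAbove 0) (i.succAbove 3) * b (i.succAbove 1) (i.succAbove 2) (i.succAbove 4)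
    - a j (i.succAbove 0) (i.succAbove 4) * b (i.succAbove 1) (i.succAbove 2) (i.succAbove 3)
    + a j (i.succAbove 1) (i.succAbove 2) * b (i.succAbove 0) (i.succAbove 3) (i.succAbove 4)
    - a j (i.succAbove 1) (i.succAbove 3) * b (i.succAbove 0) (i.succAbove 2) (i.succAbove 4)
    + a j (i.succAbove 1) (i.succAbove 4) * b (i.succAbove 0) (i.succAbove 2) (i.succAbove 3)
    + a j (i.succAbove 2) (i.succAbove 3) * b (i.succAbove 0) (i.succAbove 1) (i.succAbove 4)
    - a j (i.succAbove 2) (i.succAbove 4) * b (i.succAbove 0) (i.succAbove 1) (i.succAbove 3)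
    + a j (i.succAbove 3) (i.succAbove 4) * b (i.succAbove 0) (i.succAbove 1) (i.succAbove 2))

/-- The coefficient of `a ∧ b` with respect to the volume form. -/
def wedgeCoeff (a b : A6) : ℝ :=
  a 0 1 2 * b 3 4 5 - a 0 1 3 * b 2 4 5 + a 0 1 4 * b 2 3 5 - a 0 1 5 * b 2 3 4
    + a 0 2 3 * b 1 4 5 - a 0 2 4 * b 1 3 5 + a 0 2 5 * b 1 3 4 + a 0 3 4 * b 1 2 5
    - a 0 3 5 * b 1 2 4 + a 0 4 5 * b 1 2 3 - a 1 2 3 * b 0 4 5 + a 1 2 4 * b 0 3 5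
    - a 1 2 5 * b 0 3 4 - a 1 3 4 * b 0 2 5 + a 1 3 5 * b 0 2 4 - a 1 4 5 * b 0 2 3
    + a 2 3 4 * b 0 1 5 - a 2 3 5 * b 0 1 4 + a 2 4 5 * b 0 1 3 - a 3 4 5 * b 0 1 2

/-- Precomposition of the first argument of a trilinear form with a matrix. -/
def slot₁ (A : Matrix (Fin 6) (Fin 6) ℝ) : A6 →ₗ[ℝ] A6 where
  toFun c i j k := ∑ l, A l i * c l j k
  map_add' a b := by
    funext i j k
    simp only [Pi.add_apply, mul_add, Finset.sum_add_distrib]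
  map_smul' r a := by
    funext i j k
    simp only [Pi.smul_apply, smul_eq_mul, RingHom.id_apply, Finset.mul_sum, mul_left_comm]

/-- Precomposition of the second argument of a trilinear form with a matrix. -/
def slot₂ (A : Matrix (Fin 6) (Fin 6) ℝ) : A6 →ₗ[ℝ] A6 where
  toFun c i j k := ∑ l, A l j * c i l k
  map_add' a b := by
    funext i j k
    simp only [Pi.add_apply, mul_add, Finset.sum_add_distrib]
  map_smul' r a := by
    funext i j k
    simp only [Pi.smul_apply, smul_eq_mul, RingHom.id_apply, Finset.mul_sum, mul_left_comm]

/-- Precomposition of the third argument of a trilinear form with a matrix. -/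
def slot₃ (A : Matrix (Fin 6) (Fin 6) ℝ) : A6 →ₗ[ℝ] A6 where
  toFun c i j k := ∑ l, A l k * c i j l
  map_add' a b := by
    funext i j k
    simp only [Pi.add_apply, mul_add, Finset.sum_add_distrib]
  map_smul' r a := by
    funext i j k
    simp only [Pi.smul_apply, smul_eq_mul, RingHom.id_apply, Finset.mul_sum, mul_left_comm]

theorem slot₁_apply (A : Matrix (Fin 6) (Fin 6) ℝ) (c : A6) (i j k : Fin 6) :
    slot₁ A c i j k = ∑ l, A l i * c l j k := rfl

theorem slot₂_apply (A : Matrix (Fin 6) (Fin 6) ℝ) (c : A6) (i j k : Fin 6) :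
    slot₂ A c i j k = ∑ l, A l j * c i l k := rfl

theorem slot₃_apply (A : Matrix (Fin 6) (Fin 6) ℝ) (c : A6) (i j k : Fin 6) :
    slot₃ A c i j k = ∑ l, A l k * c i j l := rfl

theorem altForms_swap₂₃ {c : A6} (hc : c ∈ altForms) {i j k : Fin 6} (_ : k < j) :
    c i j k = -c i k j := hc.1 i j k

theorem altForms_swap₁₂ {c : A6} (hc : c ∈ altForms) {i j k : Fin 6} (_ : j < i) :
    c i j k = -c j i k := hc.2 i j k

theorem altForms_self₂₃ {c : A6} (hc : c ∈ altForms) (i j : Fin 6) : c i j j = 0 := by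
  linarith [hc.1 i j j]

theorem altForms_self₁₂ {c : A6} (hc : c ∈ altForms) (i j : Fin 6) : c i i j = 0 := by
  linarith [hc.2 i i j]

theorem hitchinMat_zero (a b : A6) (j : Fin 6) : hitchinMat a b 0 j =
    -a j 1 2 * b 3 4 5 + a j 1 3 * b 2 4 5 - a j 1 4 * b 2 3 5 + a j 1 5 * b 2 3 4
      - a j 2 3 * b 1 4 5 + a j 2 4 * b 1 3 5 - a j 2 5 * b 1 3 4 - a j 3 4 * b 1 2 5
      + a j 3 5 * b 1 2 4 - a j 4 5 * b 1 2 3 := by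
  obtain ⟨h₀, h₁, h₂, h₃, h₄⟩ : (0 : Fin 6).succAbove 0 = 1 ∧ (0 : Fin 6).succAbove 1 = 2 ∧
      (0 : Fin 6).succAbove 2 = 3 ∧ (0 : Fin 6).succAbove 3 = 4 ∧
      (0 : Fin 6).succAbove 4 = 5 := by
    decide
  simp only [hitchinMat, h₀, h₁, h₂, h₃, h₄, Fin.isValue, Fin.coe_ofNat_eq_mod]
  ring

theorem hitchinMat_one (a b : A6) (j : Fin 6) : hitchinMat a b 1 j =
    a j 0 2 * b 3 4 5 - a j 0 3 * b 2 4 5 + a j 0 4 * b 2 3 5 - a j 0 5 * b 2 3 4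
      + a j 2 3 * b 0 4 5 - a j 2 4 * b 0 3 5 + a j 2 5 * b 0 3 4 + a j 3 4 * b 0 2 5
      - a j 3 5 * b 0 2 4 + a j 4 5 * b 0 2 3 := by
  obtain ⟨h₀, h₁, h₂, h₃, h₄⟩ : (1 : Fin 6).succAbove 0 = 0 ∧ (1 : Fin 6).succAbove 1 = 2 ∧
      (1 : Fin 6).succAbove 2 = 3 ∧ (1 : Fin 6).succAbove 3 = 4 ∧
      (1 : Fin 6).succAbove 4 = 5 := by
    decide
  simp only [hitchinMat, h₀, h₁, h₂, h₃, h₄, Fin.isValue, Fin.coe_ofNat_eq_mod]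
  ring

theorem hitchinMat_two (a b : A6) (j : Fin 6) : hitchinMat a b 2 j =
    -a j 0 1 * b 3 4 5 + a j 0 3 * b 1 4 5 - a j 0 4 * b 1 3 5 + a j 0 5 * b 1 3 4
      - a j 1 3 * b 0 4 5 + a j 1 4 * b 0 3 5 - a j 1 5 * b 0 3 4 - a j 3 4 * b 0 1 5
      + a j 3 5 * b 0 1 4 - a j 4 5 * b 0 1 3 := by
  obtain ⟨h₀, h₁, h₂, h₃, h₄⟩ : (2 : Fin 6).succAbove 0 = 0 ∧ (2 : Fin 6).succAbove 1 = 1 ∧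
      (2 : Fin 6).succAbove 2 = 3 ∧ (2 : Fin 6).succAbove 3 = 4 ∧
      (2 : Fin 6).succAbove 4 = 5 := by
    decide
  simp only [hitchinMat, h₀, h₁, h₂, h₃, h₄, Fin.isValue, Fin.coe_ofNat_eq_mod]
  ring

theorem hitchinMat_three (a b : A6) (j : Fin 6) : hitchinMat a b 3 j =
    a j 0 1 * b 2 4 5 - a j 0 2 * b 1 4 5 + a j 0 4 * b 1 2 5 - a j 0 5 * b 1 2 4
      + a j 1 2 * b 0 4 5 - a j 1 4 * b 0 2 5 + a j 1 5 * b 0 2 4 + a j 2 4 * b 0 1 5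
      - a j 2 5 * b 0 1 4 + a j 4 5 * b 0 1 2 := by
  obtain ⟨h₀, h₁, h₂, h₃, h₄⟩ : (3 : Fin 6).succAbove 0 = 0 ∧ (3 : Fin 6).succAbove 1 = 1 ∧
      (3 : Fin 6).succAbove 2 = 2 ∧ (3 : Fin 6).succAbove 3 = 4 ∧
      (3 : Fin 6).succAbove 4 = 5 := by
    decide
  simp only [hitchinMat, h₀, h₁, h₂, h₃, h₄, Fin.isValue, Fin.coe_ofNat_eq_mod]
  ring

theorem hitchinMat_four (a b : A6) (j : Fin 6) : hitchinMat a b 4 j =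
    -a j 0 1 * b 2 3 5 + a j 0 2 * b 1 3 5 - a j 0 3 * b 1 2 5 + a j 0 5 * b 1 2 3
      - a j 1 2 * b 0 3 5 + a j 1 3 * b 0 2 5 - a j 1 5 * b 0 2 3 - a j 2 3 * b 0 1 5
      + a j 2 5 * b 0 1 3 - a j 3 5 * b 0 1 2 := by
  obtain ⟨h₀, h₁, h₂, h₃, h₄⟩ : (4 : Fin 6).succAbove 0 = 0 ∧ (4 : Fin 6).succAbove 1 = 1 ∧
      (4 : Fin 6).succAbove 2 = 2 ∧ (4 : Fin 6).succAbove 3 = 3 ∧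
      (4 : Fin 6).succAbove 4 = 5 := by
    decide
  simp only [hitchinMat, h₀, h₁, h₂, h₃, h₄, Fin.isValue, Fin.coe_ofNat_eq_mod]
  ring

theorem hitchinMat_five (a b : A6) (j : Fin 6) : hitchinMat a b 5 j =
    a j 0 1 * b 2 3 4 - a j 0 2 * b 1 3 4 + a j 0 3 * b 1 2 4 - a j 0 4 * b 1 2 3
      + a j 1 2 * b 0 3 4 - a j 1 3 * b 0 2 4 + a j 1 4 * b 0 2 3 + a j 2 3 * b 0 1 4
      - a j 2 4 * b 0 1 3 + a j 3 4 * b 0 1 2 := by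
  obtain ⟨h₀, h₁, h₂, h₃, h₄⟩ : (5 : Fin 6).succAbove 0 = 0 ∧ (5 : Fin 6).succAbove 1 = 1 ∧
      (5 : Fin 6).succAbove 2 = 2 ∧ (5 : Fin 6).succAbove 3 = 3 ∧
      (5 : Fin 6).succAbove 4 = 4 := by
    decide
  simp only [hitchinMat, h₀, h₁, h₂, h₃, h₄, Fin.isValue, Fin.coe_ofNat_eq_mod]
  ring

theorem forall_fin_six {P : Fin 6 → Prop} (h₀ : P 0) (h₁ : P 1) (h₂ : P 2) (h₃ : P 3)
    (h₄ : P 4) (h₅ : P 5) : ∀ i, P i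
  | 0 => h₀
  | 1 => h₁
  | 2 => h₂
  | 3 => h₃
  | 4 => h₄
  | 5 => h₅

section SlotAlgebra

variable (A B : Matrix (Fin 6) (Fin 6) ℝ) (c : A6)

theorem slot₁_slot₁ : slot₁ A (slot₁ B c) = slot₁ (B * A) c := by
  funext i j k
  simp only [slot₁_apply, Matrix.mul_apply, Finset.mul_sum, Finset.sum_mul]
  rw [Finset.sum_comm]
  exact Finset.sum_congr rfl fun _ _ => Finset.sum_congr rfl fun _ _ => by ring

theorem slot₂_slot₂ : slot₂ A (slot₂ B c) = slot₂ (B * A) c := by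
  funext i j k
  simp only [slot₂_apply, Matrix.mul_apply, Finset.mul_sum, Finset.sum_mul]
  rw [Finset.sum_comm]
  exact Finset.sum_congr rfl fun _ _ => Finset.sum_congr rfl fun _ _ => by ring

theorem slot₂_slot₁ : slot₂ B (slot₁ A c) = slot₁ A (slot₂ B c) := by
  funext i j k
  simp only [slot₁_apply, slot₂_apply, Finset.mul_sum]
  rw [Finset.sum_comm]
  exact Finset.sum_congr rfl fun _ _ => Finset.sum_congr rfl fun _ _ => by ring

theorem slot₁_add_matrix : slot₁ (A + B) c = slot₁ A c + slot₁ B c := by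
  funext i j k
  simp only [slot₁_apply, Matrix.add_apply, add_mul, Finset.sum_add_distrib, Pi.add_apply]

theorem slot₁_smul_one (r : ℝ) : slot₁ (r • 1) c = r • c := by
  funext i j k
  simp [slot₁_apply, Matrix.one_apply]

theorem slot₂_smul_one (r : ℝ) : slot₂ (r • 1) c = r • c := by
  funext i j k
  simp [slot₂_apply, Matrix.one_apply]

variable {c}

theorem slot₁_swap₂₃ (hc : c ∈ altForms) (i j k : Fin 6) :
    slot₁ A c i j k = -slot₁ A c i k j := by
  simp only [slot₁_apply, ← Finset.sum_neg_distrib]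
  exact Finset.sum_congr rfl fun l _ => by rw [hc.1 l j k]; ring

theorem slot₂_eq_neg_slot₃ (hc : c ∈ altForms) (i j k : Fin 6) :
    slot₂ A c i j k = -slot₃ A c i k j := by
  simp only [slot₂_apply, slot₃_apply, ← Finset.sum_neg_distrib]
  exact Finset.sum_congr rfl fun l _ => by rw [hc.1 i l k]; ring

theorem slot₁_eq_neg_slot₂ (hc : c ∈ altForms) (i j k : Fin 6) :
    slot₁ A c i j k = -slot₂ A c j i k := by
  simp only [slot₁_apply, slot₂_apply, ← Finset.sum_neg_distrib]
  exact Finset.sum_congr rfl fun l _ => by rw [hc.2 l j k]; ring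

theorem slot₃_swap₁₂ (hc : c ∈ altForms) (i j k : Fin 6) :
    slot₃ A c i j k = -slot₃ A c j i k := by
  simp only [slot₃_apply, ← Finset.sum_neg_distrib]
  exact Finset.sum_congr rfl fun l _ => by rw [hc.2 i j l]; ring

end SlotAlgebra

set_option maxHeartbeats 4000000 in
/-- The trilinear relation between the quadratic covariant `K`, its polarisation and the
wedge pairing. -/
theorem slot₁_polarization {c m : A6} (hc : c ∈ altForms) (hm : m ∈ altForms) :
    slot₁ (hitchinMat c m + hitchinMat m c) c =
      slot₂ (hitchinMat c c) m + slot₃ (hitchinMat c c) m + wedgeCoeff m c • c := by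
  have key : ∀ j k i : Fin 6, j < k →
      slot₁ (hitchinMat c m + hitchinMat m c) c i j k =
        (slot₂ (hitchinMat c c) m + slot₃ (hitchinMat c c) m + wedgeCoeff m c • c) i j k := by
    simp only [slot₁_apply, slot₂_apply, slot₃_apply, Pi.add_apply, Pi.smul_apply, smul_eq_mul,
      Fin.sum_univ_six, Matrix.add_apply]
    refine forall_fin_six ?_ ?_ ?_ ?_ ?_ ?_ <;> refine forall_fin_six ?_ ?_ ?_ ?_ ?_ ?_ <;>
      first
      | exact fun _ h => absurd h (by decide)
      | refine forall_fin_six ?_ ?_ ?_ ?_ ?_ ?_ <;> refine fun _ => ?_ <;>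
          simp only [wedgeCoeff, hitchinMat_zero, hitchinMat_one, hitchinMat_two,
            hitchinMat_three, hitchinMat_four, hitchinMat_five,
            altForms_self₂₃ hc, altForms_self₁₂ hc, altForms_swap₂₃ hc, altForms_swap₁₂ hc,
            altForms_self₂₃ hm, altForms_self₁₂ hm, altForms_swap₂₃ hm, altForms_swap₁₂ hm,
            Fin.reduceLT] <;>
          ring
  funext i j k
  have hanti (X : A6) (hX : ∀ j k, X i j k = -X i k j) (h : ∀ j k, j < k → X i j k = 0) :
      X i j k = 0 := by
    rcases lt_trichotomy j k with hjk | rfl | hjk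
    · exact h j k hjk
    · linarith [hX j j]
    · rw [hX j k, h k j hjk, neg_zero]
  refine sub_eq_zero.1 (hanti (slot₁ (hitchinMat c m + hitchinMat m c) c -
    (slot₂ (hitchinMat c c) m + slot₃ (hitchinMat c c) m + wedgeCoeff m c • c))
    (fun j k => ?_) (fun j k hjk => sub_eq_zero.2 (key j k i hjk)))
  simp only [Pi.sub_apply, Pi.add_apply, Pi.smul_apply, smul_eq_mul]
  linear_combination slot₁_swap₂₃ (hitchinMat c m + hitchinMat m c) hc i j k
    - slot₂_eq_neg_slot₃ (hitchinMat c c) hm i j k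
    - slot₂_eq_neg_slot₃ (hitchinMat c c) hm i k j - wedgeCoeff m c * hc.1 i j k

/-- The square of Hitchin's endomorphism is a scalar. -/
theorem hitchinMat_mul_self {c : A6} (hc : c ∈ altForms) :
    hitchinMat c c * hitchinMat c c =
      ((hitchinMat c c * hitchinMat c c).trace / 6) • (1 : Matrix (Fin 6) (Fin 6) ℝ) := by
  have key : ∀ i j : Fin 6, (hitchinMat c c * hitchinMat c c) i j =
      ((hitchinMat c c * hitchinMat c c).trace / 6) * (1 : Matrix (Fin 6) (Fin 6) ℝ) i j := by
    simp only [Matrix.mul_apply, Matrix.trace, Matrix.diag, Fin.sum_univ_six]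
    refine forall_fin_six ?_ ?_ ?_ ?_ ?_ ?_ <;> refine forall_fin_six ?_ ?_ ?_ ?_ ?_ ?_ <;>
      simp only [Matrix.one_apply, Fin.reduceEq, if_true, if_false, mul_zero, mul_one,
        hitchinMat_zero, hitchinMat_one, hitchinMat_two,
        hitchinMat_three, hitchinMat_four, hitchinMat_five,
        altForms_self₂₃ hc, altForms_self₁₂ hc, altForms_swap₂₃ hc, altForms_swap₁₂ hc,
        Fin.reduceLT] <;>
      ring
  ext i j
  simpa using key i j

/-- The endomorphism `K` is a moment map for the action of the general linear group. -/
theorem trace_mul_hitchinMat {a : A6} (ha : a ∈ altForms)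
    (b : A6) (A : Matrix (Fin 6) (Fin 6) ℝ) :
    (A * hitchinMat a b).trace = -wedgeCoeff (slot₁ A a + slot₂ A a + slot₃ A a) b := by
  simp only [Matrix.trace, Matrix.diag, Matrix.mul_apply, Fin.sum_univ_six, wedgeCoeff,
    Pi.add_apply, slot₁_apply, slot₂_apply, slot₃_apply,
    hitchinMat_zero, hitchinMat_one, hitchinMat_two,
    hitchinMat_three, hitchinMat_four, hitchinMat_five,
    altForms_self₂₃ ha, altForms_self₁₂ ha, altForms_swap₂₃ ha, altForms_swap₁₂ ha,
    Fin.reduceLT]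
  ring

theorem hitchinMat_sub_swap {a b : A6} (ha : a ∈ altForms) (hb : b ∈ altForms) :
    hitchinMat b a - hitchinMat a b = wedgeCoeff a b • (1 : Matrix (Fin 6) (Fin 6) ℝ) := by
  have key : ∀ i j : Fin 6, hitchinMat b a i j - hitchinMat a b i j =
      wedgeCoeff a b * (1 : Matrix (Fin 6) (Fin 6) ℝ) i j := by
    refine forall_fin_six ?_ ?_ ?_ ?_ ?_ ?_ <;> refine forall_fin_six ?_ ?_ ?_ ?_ ?_ ?_ <;>
      simp only [Matrix.one_apply, Fin.reduceEq, if_true, if_false, mul_zero, mul_one, wedgeCoeff,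
        hitchinMat_zero, hitchinMat_one, hitchinMat_two,
        hitchinMat_three, hitchinMat_four, hitchinMat_five,
        altForms_self₂₃ ha, altForms_self₁₂ ha, altForms_swap₂₃ ha, altForms_swap₁₂ ha,
        altForms_self₂₃ hb, altForms_self₁₂ hb, altForms_swap₂₃ hb, altForms_swap₁₂ hb,
        Fin.reduceLT] <;>
      ring
  ext i j
  simpa using key i j

theorem wedgeCoeff_swap (a b : A6) : wedgeCoeff a b = -wedgeCoeff b a := by
  simp only [wedgeCoeff]; ring

theorem wedgeCoeff_smul_right (r : ℝ) (a b : A6) :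
    wedgeCoeff a (r • b) = r * wedgeCoeff a b := by
  simp only [wedgeCoeff, Pi.smul_apply, smul_eq_mul]; ring

/-- The quartic invariant `λ` expressed through the matrix of `K`. -/
def hitchinQuartic (c : A6) : ℝ := (hitchinMat c c * hitchinMat c c).trace / 6

/-- The cubic covariant `φ(K ·, ·, ·)`. -/
def hitchinCubic (c : A6) : A6 := slot₁ (hitchinMat c c) c

section Covariants

variable {c m : A6}

theorem hitchinMat_sq (hc : c ∈ altForms) :
    hitchinMat c c * hitchinMat c c = hitchinQuartic c • (1 : Matrix (Fin 6) (Fin 6) ℝ) :=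
  hitchinMat_mul_self hc

/-- `φ(K x, y, z) = φ(x, K y, z)`. -/
theorem slot₂_hitchinMat_self (hc : c ∈ altForms) :
    slot₂ (hitchinMat c c) c = hitchinCubic c := by
  have h0 : wedgeCoeff c c = 0 := by linarith [wedgeCoeff_swap c c]
  have h := slot₁_polarization hc hc
  rw [h0, slot₁_add_matrix] at h
  funext i j k
  have h₁ := congrFun (congrFun (congrFun h i) j) k
  have h₂ := congrFun (congrFun (congrFun h j) i) k
  simp only [Pi.add_apply, zero_smul, Pi.zero_apply] at h₁ h₂
  have e₁ := slot₁_eq_neg_slot₂ (hitchinMat c c) hc i j k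
  have e₂ := slot₁_eq_neg_slot₂ (hitchinMat c c) hc j i k
  have e₃ := slot₃_swap₁₂ (hitchinMat c c) hc i j k
  simp only [hitchinCubic]
  linarith

theorem slot₃_hitchinMat_self (hc : c ∈ altForms) :
    slot₃ (hitchinMat c c) c = hitchinCubic c := by
  funext i j k
  have e₁ := slot₂_eq_neg_slot₃ (hitchinMat c c) hc i k j
  rw [slot₂_hitchinMat_self hc] at e₁
  have e₂ := slot₁_swap₂₃ (hitchinMat c c) hc i j k
  simp only [hitchinCubic] at *
  linarith

theorem hitchinCubic_mem (hc : c ∈ altForms) : hitchinCubic c ∈ altForms := by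
  refine ⟨slot₁_swap₂₃ (hitchinMat c c) hc, fun i j k => ?_⟩
  have e := slot₁_eq_neg_slot₂ (hitchinMat c c) hc i j k
  rwa [slot₂_hitchinMat_self hc] at e

theorem slot₁_hitchinCubic (hc : c ∈ altForms) :
    slot₁ (hitchinMat c c) (hitchinCubic c) = hitchinQuartic c • c := by
  rw [hitchinCubic, slot₁_slot₁, hitchinMat_sq hc, slot₁_smul_one]

theorem trace_hitchinMat (hc : c ∈ altForms) : (hitchinMat c c).trace = 0 := by
  have h := trace_mul_hitchinMat hc c (1 : Matrix (Fin 6) (Fin 6) ℝ)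
  have h1 : slot₁ (1 : Matrix (Fin 6) (Fin 6) ℝ) c = c := by
    simpa using slot₁_smul_one c 1
  have h2 : slot₂ (1 : Matrix (Fin 6) (Fin 6) ℝ) c = c := by
    simpa using slot₂_smul_one c 1
  have h3 : slot₃ (1 : Matrix (Fin 6) (Fin 6) ℝ) c = c := by
    funext i j k
    simp [slot₃_apply, Matrix.one_apply]
  rw [h1, h2, h3, one_mul] at h
  rw [h]
  simp only [wedgeCoeff, Pi.add_apply]
  ring

theorem trace_hitchinMat_mul (hc : c ∈ altForms) (m : A6) :
    (hitchinMat c c * hitchinMat c m).trace = 3 * wedgeCoeff m (hitchinCubic c) := by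
  rw [trace_mul_hitchinMat hc, slot₂_hitchinMat_self hc, slot₃_hitchinMat_self hc,
    wedgeCoeff_swap m]
  simp only [hitchinCubic, wedgeCoeff, Pi.add_apply]
  ring

theorem wedgeCoeff_hitchinCubic (hc : c ∈ altForms) :
    wedgeCoeff c (hitchinCubic c) = 2 * hitchinQuartic c := by
  have h := trace_hitchinMat_mul hc c
  rw [hitchinQuartic]
  linarith

theorem trace_hitchinMat_mul_polarization (hc : c ∈ altForms) (hm : m ∈ altForms) :
    (hitchinMat c c * (hitchinMat c m + hitchinMat m c)).trace =
      6 * wedgeCoeff m (hitchinCubic c) := by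
  have h : hitchinMat m c = hitchinMat c m + wedgeCoeff c m • 1 := by
    rw [← hitchinMat_sub_swap hc hm]; abel
  rw [h, mul_add, mul_add, Matrix.trace_add, Matrix.trace_add, mul_smul_comm, mul_one,
    Matrix.trace_smul, trace_hitchinMat hc, trace_hitchinMat_mul hc]
  simp only [smul_eq_mul]
  ring

theorem hitchinMat_add_smul (c m : A6) (s : ℝ) :
    hitchinMat (c + s • m) (c + s • m) =
      hitchinMat c c + s • (hitchinMat c m + hitchinMat m c) + s ^ 2 • hitchinMat m m := by
  ext i j
  simp only [hitchinMat, Pi.add_apply, Pi.smul_apply, smul_eq_mul, Matrix.add_apply,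
    Matrix.smul_apply]
  ring

theorem hitchinMat_anticommutator (hc : c ∈ altForms) (hm : m ∈ altForms) :
    hitchinMat c c * (hitchinMat c m + hitchinMat m c) +
        (hitchinMat c m + hitchinMat m c) * hitchinMat c c =
      (2 * wedgeCoeff m (hitchinCubic c)) • (1 : Matrix (Fin 6) (Fin 6) ℝ) := by
  have hs (s : ℝ) : c + s • m ∈ altForms :=
    altForms.add_mem hc (altForms.smul_mem s hm)
  have hq (s : ℝ) := hitchinMat_mul_self (hs s)
  have ht := trace_hitchinMat_mul_polarization hc hm
  simp only [hitchinMat_add_smul] at hq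
  set k := hitchinMat c c
  set p := hitchinMat c m + hitchinMat m c
  set q := hitchinMat m m
  have expand (s : ℝ) : (k + s • p + s ^ 2 • q) * (k + s • p + s ^ 2 • q) =
      k * k + s • (k * p + p * k) + s ^ 2 • (k * q + q * k + p * p) +
        s ^ 3 • (p * q + q * p) + s ^ 4 • (q * q) := by
    simp only [mul_add, add_mul, mul_smul_comm, smul_mul_assoc, smul_smul, smul_add]
    module
  have comb : k * p + p * k = (12 : ℝ)⁻¹ •
      ((8 : ℝ) • ((k + (1 : ℝ) • p + (1 : ℝ) ^ 2 • q) * (k + (1 : ℝ) • p + (1 : ℝ) ^ 2 • q))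
      - (8 : ℝ) • ((k + (-1 : ℝ) • p + (-1 : ℝ) ^ 2 • q) * (k + (-1 : ℝ) • p + (-1 : ℝ) ^ 2 • q))
      - (k + (2 : ℝ) • p + (2 : ℝ) ^ 2 • q) * (k + (2 : ℝ) • p + (2 : ℝ) ^ 2 • q)
      + (k + (-2 : ℝ) • p + (-2 : ℝ) ^ 2 • q) * (k + (-2 : ℝ) • p + (-2 : ℝ) ^ 2 • q)) := by
    simp only [expand]
    module
  obtain ⟨x, hx⟩ : ∃ x : ℝ, k * p + p * k = x • (1 : Matrix (Fin 6) (Fin 6) ℝ) := by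
    rw [comb, hq 1, hq (-1), hq 2, hq (-2)]
    simp only [smul_smul, ← sub_smul, ← add_smul]
    exact ⟨_, rfl⟩
  have htr := congrArg Matrix.trace hx
  rw [Matrix.trace_add, Matrix.trace_mul_comm p k, ht, Matrix.trace_smul, Matrix.trace_one] at htr
  have hx' : x = 2 * wedgeCoeff m (hitchinCubic c) := by
    simp only [Fintype.card_fin, smul_eq_mul] at htr
    push_cast at htr
    linarith
  rw [hx, hx']

/-- The form `m(K ·, K ·, K ·)` in terms of the infinitesimal action of `K` on `m`. -/
theorem slot₁_slot₂_slot₃_hitchinMat (hc : c ∈ altForms) (hm : m ∈ altForms) :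
    slot₁ (hitchinMat c c) (slot₂ (hitchinMat c c) (slot₃ (hitchinMat c c) m)) =
      (2 * wedgeCoeff m (hitchinCubic c)) • hitchinCubic c
        - (2 * wedgeCoeff m c * hitchinQuartic c) • c
        - hitchinQuartic c • (slot₁ (hitchinMat c c) m + slot₂ (hitchinMat c c) m
          + slot₃ (hitchinMat c c) m) := by
  have hanti := congrArg (fun A => slot₁ A c) (hitchinMat_anticommutator hc hm)
  have hsq := hitchinMat_sq hc
  have hpol := slot₁_polarization hc hm
  have h₂ := slot₂_hitchinMat_self hc
  have h₁ := slot₁_hitchinCubic hc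
  simp only [slot₁_smul_one, slot₁_add_matrix _ (_ * _)] at hanti
  rw [← slot₁_slot₁, ← slot₁_slot₁, hpol, show slot₁ (hitchinMat c c) c = hitchinCubic c from rfl,
    ← h₂, ← slot₂_slot₁, hpol] at hanti
  simp only [map_add, map_smul, slot₂_slot₂, hsq, slot₂_smul_one, h₂] at hanti
  have happ := congrArg (slot₁ (hitchinMat c c)) hanti
  simp only [map_add, map_smul, h₁, slot₁_slot₁, hsq, slot₁_smul_one] at happ
  rw [show slot₁ (hitchinMat c c) c = hitchinCubic c from rfl] at happ
  rw [← happ]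
  module

end Covariants

section Interpretation

theorem tri_eq_sum (c : A6) (x y z : V6) :
    tri c x y z = ∑ i, x i * ∑ j, y j * ∑ k, z k * c i j k := by
  simp only [tri, Finset.mul_sum]
  exact Finset.sum_congr rfl fun _ _ => Finset.sum_congr rfl fun _ _ =>
    Finset.sum_congr rfl fun _ _ => by ring

theorem tri_e6_right (c : A6) (x : V6) (j k : Fin 6) :
    tri c x (e6 j) (e6 k) = ∑ i, x i * c i j k := by
  simp [tri_eq_sum, e6]

theorem tri_e6 (c : A6) (i j k : Fin 6) : tri c (e6 i) (e6 j) (e6 k) = c i j k := by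
  simp [tri_eq_sum, e6]

theorem tri_mulVec₁ (A : Matrix (Fin 6) (Fin 6) ℝ) (c : A6) (x y z : V6) :
    tri c (A.mulVec x) y z = tri (slot₁ A c) x y z := by
  simp only [tri, slot₁_apply, Matrix.mulVec, dotProduct, Finset.mul_sum, Finset.sum_mul]
  rw [Finset.sum_congr rfl fun i _ => Finset.sum_comm_cycle, Finset.sum_comm]
  refine Finset.sum_congr rfl fun l _ => ?_
  rw [← Finset.sum_comm_cycle]
  exact Finset.sum_congr rfl fun _ _ => Finset.sum_congr rfl fun _ _ =>
    Finset.sum_congr rfl fun _ _ => by ring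

theorem tri_mulVec₂ (A : Matrix (Fin 6) (Fin 6) ℝ) (c : A6) (x y z : V6) :
    tri c x (A.mulVec y) z = tri (slot₂ A c) x y z := by
  simp only [tri, slot₂_apply, Matrix.mulVec, dotProduct, Finset.mul_sum, Finset.sum_mul]
  refine Finset.sum_congr rfl fun i _ => ?_
  rw [Finset.sum_comm_cycle]
  refine Finset.sum_congr rfl fun l _ => ?_
  rw [Finset.sum_comm]
  exact Finset.sum_congr rfl fun _ _ => Finset.sum_congr rfl fun _ _ => by ring

theorem tri_mulVec₃ (A : Matrix (Fin 6) (Fin 6) ℝ) (c : A6) (x y z : V6) :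
    tri c x y (A.mulVec z) = tri (slot₃ A c) x y z := by
  simp only [tri_eq_sum, slot₃_apply, Matrix.mulVec, dotProduct, Finset.mul_sum, Finset.sum_mul]
  refine Finset.sum_congr rfl fun i _ => Finset.sum_congr rfl fun j _ => ?_
  rw [Finset.sum_comm]
  refine Finset.sum_congr rfl fun k _ => Finset.sum_congr rfl fun l _ => by ring

theorem tri_smul_args (c : A6) (r : ℝ) (x y z : V6) :
    tri c (r • x) (r • y) (r • z) = tri (r ^ 3 • c) x y z := by
  simp only [tri, Pi.smul_apply, smul_eq_mul]
  exact Finset.sum_congr rfl fun _ _ => Finset.sum_congr rfl fun _ _ =>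
    Finset.sum_congr rfl fun _ _ => by ring

theorem tri_swap₂₃ {c : A6} (hc : c ∈ altForms) (x y z : V6) : tri c x y z = -tri c x z y := by
  simp only [tri, ← Finset.sum_neg_distrib]
  refine Finset.sum_congr rfl fun i _ => ?_
  rw [Finset.sum_comm]
  exact Finset.sum_congr rfl fun k _ => Finset.sum_congr rfl fun j _ => by
    rw [hc.1 i j k]; ring

theorem tri_swap₁₂ {c : A6} (hc : c ∈ altForms) (x y z : V6) : tri c x y z = -tri c y x z := by
  simp only [tri, ← Finset.sum_neg_distrib]
  rw [Finset.sum_comm]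
  exact Finset.sum_congr rfl fun j _ => Finset.sum_congr rfl fun i _ =>
    Finset.sum_congr rfl fun k _ => by rw [hc.2 i j k]; ring

variable {c m : A6}

theorem Kmap_tri (hc : c ∈ altForms) (x : V6) :
    Kmap (tri c) x = (hitchinMat c c).mulVec x := by
  funext i
  have h := sum_perm_five_of_alternating
    (A := fun p q => tri c x (e6 (i.succAbove p)) (e6 (i.succAbove q)))
    (B := fun p q r => tri c (e6 (i.succAbove p)) (e6 (i.succAbove q)) (e6 (i.succAbove r)))
    (fun _ _ => tri_swap₂₃ hc _ _ _) (fun _ _ _ => tri_swap₂₃ hc _ _ _)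
    (fun _ _ _ => tri_swap₁₂ hc _ _ _)
  simp only [Kmap, wedge23]
  rw [h]
  simp only [tri_e6]
  simp only [tri_e6_right, Matrix.mulVec, dotProduct, hitchinMat, Finset.sum_mul,
    ← Finset.sum_sub_distrib, ← Finset.sum_add_distrib, Finset.mul_sum,
    ← Finset.sum_neg_distrib]
  exact Finset.sum_congr rfl fun _ _ => by ring

theorem lamH_tri (hc : c ∈ altForms) : lamH (tri c) = hitchinQuartic c := by
  have he (i : Fin 6) : e6 i = Pi.single i 1 := by
    funext j
    simp [e6, Pi.single_apply]
  simp only [lamH, Kmap_tri hc, Matrix.mulVec_mulVec, he]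
  rw [hitchinQuartic, div_eq_inv_mul, div_eq_inv_mul, mul_one, Matrix.trace]
  simp only [Matrix.mulVec_single_one, Matrix.col_apply, Matrix.diag_apply]

theorem tri_add₁ (c : A6) (x x' y z : V6) : tri c (x + x') y z = tri c x y z + tri c x' y z := by
  simp only [tri, Pi.add_apply, mul_add, add_mul, Finset.sum_add_distrib]

theorem tri_add₂ (c : A6) (x y y' z : V6) : tri c x (y + y') z = tri c x y z + tri c x y' z := by
  simp only [tri, Pi.add_apply, mul_add, add_mul, Finset.sum_add_distrib]

theorem tri_add₃ (c : A6) (x y z z' : V6) : tri c x y (z + z') = tri c x y z + tri c x y z' := by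
  simp only [tri, Pi.add_apply, mul_add, Finset.sum_add_distrib]

theorem tri_smul₁ (c : A6) (r : ℝ) (x y z : V6) : tri c (r • x) y z = r * tri c x y z := by
  simp only [tri_eq_sum, Pi.smul_apply, smul_eq_mul, Finset.mul_sum, mul_left_comm, mul_assoc]

theorem tri_smul₂ (c : A6) (r : ℝ) (x y z : V6) : tri c x (r • y) z = r * tri c x y z := by
  simp only [tri_eq_sum, Pi.smul_apply, smul_eq_mul, Finset.mul_sum, mul_left_comm, mul_assoc]

theorem tri_smul₃ (c : A6) (r : ℝ) (x y z : V6) : tri c x y (r • z) = r * tri c x y z := by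
  simp only [tri_eq_sum, Pi.smul_apply, smul_eq_mul, Finset.mul_sum, mul_left_comm, mul_assoc]

/-- The product of two trilinear forms as a multilinear map in six vectors. -/
def triProd (a b : A6) : MultilinearMap ℝ (fun _ : Fin 6 => V6) ℝ where
  toFun v := tri a (v 0) (v 1) (v 2) * tri b (v 3) (v 4) (v 5)
  map_update_add' := by
    intro inst v i x y
    obtain rfl := Subsingleton.elim inst (instDecidableEqFin 6)
    fin_cases i <;>
      simp [tri_add₁, tri_add₂, tri_add₃, mul_add, add_mul]
  map_update_smul' := by
    intro inst v i r x
    obtain rfl := Subsingleton.elim inst (instDecidableEqFin 6)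
    fin_cases i <;>
      simp [tri_smul₁, tri_smul₂, tri_smul₃, mul_left_comm, mul_assoc]

theorem wedge33_tri {a b : A6} (ha : a ∈ altForms) (hb : b ∈ altForms) (v : Fin 6 → V6) :
    wedge33 (tri a) (tri b) v = wedgeCoeff a b * vol6 v := by
  have halt (w : Fin 6 → V6) : wedge33 (tri a) (tri b) w =
      (1 / 36 : ℝ) * MultilinearMap.alternatization (triProd a b) w := by
    simp only [wedge33, MultilinearMap.alternatization_apply, MultilinearMap.domDomCongr_apply,
      Units.smul_def, zsmul_eq_mul]
    rfl
  have hdet := AlternatingMap.eq_smul_basis_det (Pi.basisFun ℝ (Fin 6))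
    (MultilinearMap.alternatization (triProd a b))
  have hbasis : (⇑(Pi.basisFun ℝ (Fin 6)) : Fin 6 → V6) = e6 := by
    funext i j
    simp [e6, Pi.single_apply]
  have hcoeff : wedge33 (tri a) (tri b) e6 = wedgeCoeff a b := by
    simp only [wedge33, tri_e6]
    rw [sum_perm_six_of_alternating ha.1 ha.2 hb.1 hb.2, wedgeCoeff]
    ring
  have hv := congrArg (fun f => f v) hdet
  simp only [AlternatingMap.smul_apply, hbasis, smul_eq_mul, Pi.basisFun_det] at hv
  have hvol : vol6 v = Matrix.detRowAlternating v := by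
    rw [vol6, Matrix.det]
    exact congrArg (fun w : Fin 6 → V6 => Matrix.detRowAlternating w) rfl
  rw [halt, hv, ← hcoeff, halt, mul_assoc, hvol]

/-- Where `λ < 0`, `φ̂` is a multiple of `φ(K ·, ·, ·)`. -/
theorem hatf_tri (hc : c ∈ altForms) (hneg : hitchinQuartic c < 0) (x y z : V6) :
    hatf (tri c) x y z = tri (-(√(-hitchinQuartic c))⁻¹ • hitchinCubic c) x y z := by
  have hs : 0 < √(-hitchinQuartic c) := Real.sqrt_pos.2 (by linarith)
  have hsq : √(-hitchinQuartic c) ^ 2 = -hitchinQuartic c := Real.sq_sqrt (by linarith)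
  simp only [hatf, Jmap, lamH_tri hc, Kmap_tri hc, tri_smul_args, tri_mulVec₁, tri_mulVec₂,
    tri_mulVec₃, map_smul, slot₃_hitchinMat_self hc]
  congr 1
  rw [hitchinCubic, slot₂_slot₁, slot₁_slot₁, hitchinMat_sq hc, slot₁_smul_one,
    slot₂_hitchinMat_self hc, hitchinCubic, smul_smul]
  congr 1
  generalize √(-hitchinQuartic c) = s at hs hsq
  rw [show hitchinQuartic c = -s ^ 2 by linarith]
  field_simp

theorem hatMap_apply (a : altForms) (hneg : hitchinQuartic a.1 < 0) :
    hatMap a = -(√(-hitchinQuartic a.1))⁻¹ • hitchinCubic a.1 := by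
  funext i j k
  rw [hatMap, hatf_tri a.2 hneg, tri_e6]

end Interpretation

section Calculus

theorem tri_Jmap {c : A6} (hc : c ∈ altForms) (m : A6) (x y z : V6) :
    tri m (Jmap (tri c) x) (Jmap (tri c) y) (Jmap (tri c) z) =
      tri ((√(-hitchinQuartic c))⁻¹ ^ 3 • slot₁ (hitchinMat c c) (slot₂ (hitchinMat c c)
        (slot₃ (hitchinMat c c) m))) x y z := by
  simp only [Jmap, lamH_tri hc, Kmap_tri hc]
  rw [tri_smul_args, tri_mulVec₃, tri_mulVec₂, tri_mulVec₁, map_smul, map_smul, map_smul]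

theorem differentiable_hitchinMat (i j : Fin 6) :
    Differentiable ℝ fun c : A6 => hitchinMat c c i j := by
  unfold hitchinMat
  fun_prop

theorem differentiable_hitchinQuartic : Differentiable ℝ hitchinQuartic := by
  unfold hitchinQuartic
  simp only [Matrix.trace, Matrix.diag_apply, Matrix.mul_apply]
  have h := differentiable_hitchinMat
  fun_prop

theorem differentiable_hitchinCubic : Differentiable ℝ hitchinCubic := by
  have h := differentiable_hitchinMat
  refine differentiable_pi.2 fun i => differentiable_pi.2 fun j => differentiable_pi.2 fun k => ?_
  simp only [hitchinCubic, slot₁_apply]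
  fun_prop

theorem hatMap_eventuallyEq {c : altForms} (hneg : hitchinQuartic c.1 < 0) :
    hatMap =ᶠ[nhds c] fun a => -(√(-hitchinQuartic a.1))⁻¹ • hitchinCubic a.1 := by
  have hcont : Continuous fun a : altForms => hitchinQuartic a.1 :=
    differentiable_hitchinQuartic.continuous.comp continuous_subtype_val
  filter_upwards [hcont.continuousAt.eventually_lt continuousAt_const hneg] with a ha
  exact hatMap_apply a ha

theorem differentiableAt_hatMap {c : altForms} (hneg : hitchinQuartic c.1 < 0) :
    DifferentiableAt ℝ hatMap c := by
  refine DifferentiableAt.congr_of_eventuallyEq ?_ (hatMap_eventuallyEq hneg)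
  have hval : Differentiable ℝ fun a : altForms => a.1 := altForms.subtypeL.differentiable
  have hQ : Differentiable ℝ fun a : altForms => hitchinQuartic a.1 :=
    differentiable_hitchinQuartic.comp hval
  have hΨ : Differentiable ℝ fun a : altForms => hitchinCubic a.1 :=
    differentiable_hitchinCubic.comp hval
  have hpos : 0 < -hitchinQuartic c.1 := by linarith
  exact (((hQ.neg c).sqrt hpos.ne').inv (Real.sqrt_pos.2 hpos).ne').neg.smul (hΨ c)

theorem hasDerivAt_hitchinMat_line (c m : A6) (i j : Fin 6) :
    HasDerivAt (fun s : ℝ => hitchinMat (c + s • m) (c + s • m) i j)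
      ((hitchinMat c m + hitchinMat m c) i j) 0 := by
  have h : HasDerivAt (fun s : ℝ => hitchinMat c c i j
      + s * (hitchinMat c m + hitchinMat m c) i j + s ^ 2 * hitchinMat m m i j)
      (1 * (hitchinMat c m + hitchinMat m c) i j
        + ((2 : ℕ) * (0 : ℝ) ^ (2 - 1)) * hitchinMat m m i j) 0 :=
    (((hasDerivAt_id (0 : ℝ)).mul_const _).const_add _).add
      ((hasDerivAt_pow 2 (0 : ℝ)).mul_const _)
  convert h using 1
  · funext s
    rw [hitchinMat_add_smul]
    rfl
  · simp

variable {c m : A6}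

theorem hasDerivAt_hitchinQuartic_line (hc : c ∈ altForms) (hm : m ∈ altForms) :
    HasDerivAt (fun s : ℝ => hitchinQuartic (c + s • m))
      (2 * wedgeCoeff m (hitchinCubic c)) 0 := by
  have hK := hasDerivAt_hitchinMat_line c m
  have h := (HasDerivAt.fun_sum (u := Finset.univ) fun i _ =>
    HasDerivAt.fun_sum (u := Finset.univ) fun l _ => (hK i l).mul (hK l i)).div_const 6
  have ht := trace_hitchinMat_mul_polarization hc hm
  have ht' := ht
  rw [Matrix.trace_mul_comm] at ht'
  simp only [Matrix.trace, Matrix.diag_apply, Matrix.mul_apply] at ht ht'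
  simp only [zero_smul, add_zero, Finset.sum_add_distrib] at h
  rw [ht, ht'] at h
  exact h.congr_deriv (by ring)

theorem hasDerivAt_hitchinCubic_line (hc : c ∈ altForms) (hm : m ∈ altForms) :
    HasDerivAt (fun s : ℝ => hitchinCubic (c + s • m))
      (slot₁ (hitchinMat c c) m + slot₂ (hitchinMat c c) m + slot₃ (hitchinMat c c) m
        + wedgeCoeff m c • c) 0 := by
  have hval : slot₁ (hitchinMat c c) m + slot₂ (hitchinMat c c) m + slot₃ (hitchinMat c c) m
      + wedgeCoeff m c • c = slot₁ (hitchinMat c m + hitchinMat m c) c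
        + slot₁ (hitchinMat c c) m := by
    rw [slot₁_polarization hc hm]
    abel
  rw [hval]
  refine hasDerivAt_pi.2 fun i => hasDerivAt_pi.2 fun j => hasDerivAt_pi.2 fun k => ?_
  have hl (l : Fin 6) : HasDerivAt (fun s : ℝ => (c + s • m) l j k) (m l j k) 0 := by
    simpa using ((hasDerivAt_id (0 : ℝ)).mul_const (m l j k)).const_add (c l j k)
  have h := HasDerivAt.fun_sum (u := Finset.univ) fun l _ =>
    (hasDerivAt_hitchinMat_line c m l i).mul (hl l)
  simp only [zero_smul, add_zero, Finset.sum_add_distrib] at h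
  exact h

theorem hasDerivAt_hatMap_line {c m : altForms} (hneg : hitchinQuartic c.1 < 0) {s : ℝ}
    (hs : s = √(-hitchinQuartic c.1)) :
    HasDerivAt (fun t : ℝ => hatMap (c + t • m))
      (-s⁻¹ • (slot₁ (hitchinMat c.1 c.1) m.1 + slot₂ (hitchinMat c.1 c.1) m.1
          + slot₃ (hitchinMat c.1 c.1) m.1 + wedgeCoeff m.1 c.1 • c.1)
        - (wedgeCoeff m.1 (hitchinCubic c.1) / s ^ 3) • hitchinCubic c.1) 0 := by
  have hpos : 0 < -hitchinQuartic c.1 := by linarith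
  have hs0 : 0 < s := hs ▸ Real.sqrt_pos.2 hpos
  have hline : Filter.Tendsto (fun t : ℝ => c + t • m) (nhds 0) (nhds c) := by
    have : Continuous fun t : ℝ => c + t • m := by fun_prop
    simpa using this.tendsto 0
  refine HasDerivAt.congr_of_eventuallyEq ?_ (hline.eventually (hatMap_eventuallyEq hneg))
  have hΨ := hasDerivAt_hitchinCubic_line c.2 m.2
  have hQ := (hasDerivAt_hitchinQuartic_line c.2 m.2).neg
  have hpos' : -hitchinQuartic (c.1 + (0 : ℝ) • m.1) ≠ 0 := by simpa using hpos.ne'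
  have hr := hQ.sqrt hpos'
  have hi := (hr.inv (by simpa using (Real.sqrt_pos.2 hpos).ne')).neg
  have h := hi.smul hΨ
  simp only [Pi.neg_apply, Pi.inv_apply, zero_smul, add_zero, ← hs] at h
  convert h using 1
  · rfl
  · rw [sub_eq_add_neg, ← neg_smul]
    congr 2
    field_simp

end Calculus
/-- Variation of `φ̂`: the map `φ ↦ φ̂` is differentiable on the open set
`U = {φ : λ_φ < 0}`, `φ ∧ φ̂ = 2√(−λ_φ)·vol ≠ 0` on `U`, and its derivative at `φ` in the
direction μ equals `−μ∘(J_φ×J_φ×J_φ) + 2r₁·φ + 2r₂·φ̂`, where `r₁, r₂` are determined by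
`μ ∧ φ = r₁·(φ ∧ φ̂)` and `μ ∧ φ̂ = r₂·(φ ∧ φ̂)`. -/
theorem variation_of_phi_hat :
    DifferentiableOn ℝ hatMap {c : altForms | lamH (tri c.1) < 0} ∧
    (∀ c : altForms, lamH (tri c.1) < 0 →
      ((∀ v : Fin 6 → V6,
          wedge33 (tri c.1) (hatf (tri c.1)) v
            = 2 * Real.sqrt (-(lamH (tri c.1))) * vol6 v) ∧
        2 * Real.sqrt (-(lamH (tri c.1))) ≠ 0) ∧
      ∀ m : altForms, ∃ r₁ r₂ : ℝ,
        (∀ v : Fin 6 → V6,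
          wedge33 (tri m.1) (tri c.1) v = r₁ * wedge33 (tri c.1) (hatf (tri c.1)) v) ∧
        (∀ v : Fin 6 → V6,
          wedge33 (tri m.1) (hatf (tri c.1)) v = r₂ * wedge33 (tri c.1) (hatf (tri c.1)) v) ∧
        HasDerivAt (fun s : ℝ => hatMap (c + s • m))
          ((fun i j k =>
            -(tri m.1 (Jmap (tri c.1) (e6 i)) (Jmap (tri c.1) (e6 j)) (Jmap (tri c.1) (e6 k)))
              + 2 * r₁ * tri c.1 (e6 i) (e6 j) (e6 k)
              + 2 * r₂ * hatf (tri c.1) (e6 i) (e6 j) (e6 k)) : A6) 0) := by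
  have hhat (c : altForms) (hneg : hitchinQuartic c.1 < 0) : hatf (tri c.1) =
      tri (-(√(-hitchinQuartic c.1))⁻¹ • hitchinCubic c.1) := by
    funext x y z
    exact hatf_tri c.2 hneg x y z
  refine ⟨fun c hc => ?_, fun c hneg => ?_⟩
  · rw [Set.mem_ofPred_eq, lamH_tri c.2] at hc
    exact (differentiableAt_hatMap hc).differentiableWithinAt
  rw [lamH_tri c.2] at hneg ⊢
  rw [hhat c hneg]
  have hpos : 0 < -hitchinQuartic c.1 := by linarith
  obtain ⟨s, hs⟩ : ∃ s, s = √(-hitchinQuartic c.1) := ⟨_, rfl⟩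
  have hs0 : 0 < s := hs ▸ Real.sqrt_pos.2 hpos
  have hsq : hitchinQuartic c.1 = -s ^ 2 := by
    rw [hs, Real.sq_sqrt hpos.le, neg_neg]
  have hmem : -s⁻¹ • hitchinCubic c.1 ∈ altForms :=
    altForms.smul_mem _ (hitchinCubic_mem c.2)
  rw [← hs]
  have hself (v : Fin 6 → V6) : wedge33 (tri c.1) (tri (-s⁻¹ • hitchinCubic c.1)) v =
      2 * s * vol6 v := by
    rw [wedge33_tri c.2 hmem, wedgeCoeff_smul_right, wedgeCoeff_hitchinCubic c.2, hsq]
    field_simp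
  refine ⟨⟨hself, by positivity⟩, fun m => ⟨wedgeCoeff m.1 c.1 / (2 * s),
    -wedgeCoeff m.1 (hitchinCubic c.1) / (2 * s ^ 2), fun v => ?_, fun v => ?_, ?_⟩⟩
  · rw [hself, wedge33_tri m.2 c.2]
    field_simp
  · rw [hself, wedge33_tri m.2 hmem, wedgeCoeff_smul_right]
    field_simp
  · convert hasDerivAt_hatMap_line hneg hs using 1
    have hmod : -(s⁻¹ ^ 3 • slot₁ (hitchinMat c.1 c.1) (slot₂ (hitchinMat c.1 c.1)
          (slot₃ (hitchinMat c.1 c.1) m.1)))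
          + (2 * (wedgeCoeff m.1 c.1 / (2 * s))) • c.1
          + (2 * (-wedgeCoeff m.1 (hitchinCubic c.1) / (2 * s ^ 2))) •
            (-s⁻¹ • hitchinCubic c.1) =
        -s⁻¹ • (slot₁ (hitchinMat c.1 c.1) m.1 + slot₂ (hitchinMat c.1 c.1) m.1
          + slot₃ (hitchinMat c.1 c.1) m.1 + wedgeCoeff m.1 c.1 • c.1)
        - (wedgeCoeff m.1 (hitchinCubic c.1) / s ^ 3) • hitchinCubic c.1 := by
      rw [slot₁_slot₂_slot₃_hitchinMat c.2 m.2, hsq]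
      match_scalars <;> field_simp <;> ring
    rw [← hmod]
    funext i j k
    rw [tri_Jmap c.2, ← hs, tri_e6, tri_e6, tri_e6]
    rfl
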